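/- The maximum likelihood estimator is unique: if Ĝ₁ and Ĝ₂ are probability measures on (0, ∞) with L(Ĝ₁) ≥ L(G) and L(Ĝ₂) ≥ L(G) for all probability measures G on (0, ∞), then Ĝ₁ = Ĝ₂. -/

import Mathlib

open Set MeasureTheory

/-- The `k`-monotone mixture density `f_G(x) = ∫ k (y - x)₊^{k-1} / y^k dG(y)`. -/
noncomputable def mixDens (k : ℕ) (G : Measure ℝ) (x : ℝ) : ℝ :=
  ∫ y, (k : ℝ) * max (y - x) 0 ^ (k - 1) / y ^ k ∂G

/-- The likelihood of the mixing measure `G` given observations `X₁, …, X_n`. -/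
noncomputable def lik (k n : ℕ) (X : Fin n → ℝ) (G : Measure ℝ) : ℝ :=
  ∏ i, mixDens k G (X i)

/-- The truncated power `t₊^m / m!`, with the convention that `t₊^0` is the indicator of `t > 0`. -/
noncomputable def truncPow (m : ℕ) (t : ℝ) : ℝ :=
  if 0 < t then t ^ m / m.factorial else 0

lemma truncPow_of_pos {m : ℕ} {t : ℝ} (ht : 0 < t) : truncPow m t = t ^ m / m.factorial :=
  if_pos ht

lemma truncPow_of_nonpos {m : ℕ} {t : ℝ} (ht : t ≤ 0) : truncPow m t = 0 :=
  if_neg ht.not_gt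

lemma truncPow_succ (m : ℕ) (t : ℝ) :
    truncPow (m + 1) t = max t 0 ^ (m + 1) / (m + 1).factorial := by
  rcases le_or_gt t 0 with h | h
  · simp [truncPow_of_nonpos h, max_eq_right h]
  · rw [truncPow_of_pos h, max_eq_left h.le]

lemma continuous_truncPow_succ (m : ℕ) : Continuous (truncPow (m + 1)) := by
  rw [funext (truncPow_succ m)]
  fun_prop

lemma monotone_truncPow (m : ℕ) : Monotone (truncPow m) := by
  intro s t hst
  rcases le_or_gt s 0 with h | h
  · rw [truncPow_of_nonpos h]
    unfold truncPow
    split_ifs <;> positivity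
  · rw [truncPow_of_pos h, truncPow_of_pos (h.trans_le hst)]
    gcongr

lemma hasDerivAt_truncPow_succ (m : ℕ) {t : ℝ} (ht : t ≠ 0) :
    HasDerivAt (truncPow (m + 1)) (truncPow m t) t := by
  rcases ht.lt_or_gt with h | h
  · rw [truncPow_of_nonpos h.le]
    refine (hasDerivAt_const t (0 : ℝ)).congr_of_eventuallyEq ?_
    filter_upwards [eventually_lt_nhds h] with s hs using truncPow_of_nonpos hs.le
  · rw [truncPow_of_pos h]
    have hd : HasDerivAt (fun s : ℝ => s ^ (m + 1) / (m + 1).factorial)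
        (t ^ m / m.factorial) t := by
      refine ((hasDerivAt_pow (m + 1) t).div_const ((m + 1).factorial : ℝ)).congr_deriv ?_
      rw [Nat.factorial_succ]
      push_cast
      field_simp
    refine hd.congr_of_eventuallyEq ?_
    filter_upwards [eventually_gt_nhds h] with s hs using truncPow_of_pos hs

/-- `f` is an indefinite integral of `f'`. -/
def IsPrimitive (f f' : ℝ → ℝ) : Prop :=
  (∀ a b, IntervalIntegrable f' volume a b) ∧ ∀ a b, ∫ x in a..b, f' x = f b - f a

namespace IsPrimitive

lemma const_mul {f f' : ℝ → ℝ} (h : IsPrimitive f f') (c : ℝ) :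
    IsPrimitive (fun x => c * f x) (fun x => c * f' x) :=
  ⟨fun a b => (h.1 a b).const_mul c, fun a b => by
    rw [intervalIntegral.integral_const_mul, h.2]; ring⟩

lemma sub {f f' g g' : ℝ → ℝ} (hf : IsPrimitive f f') (hg : IsPrimitive g g') :
    IsPrimitive (fun x => f x - g x) (fun x => f' x - g' x) :=
  ⟨fun a b => (hf.1 a b).sub (hg.1 a b), fun a b => by
    rw [intervalIntegral.integral_sub (hf.1 a b) (hg.1 a b), hf.2, hg.2]; ring⟩

lemma sum {S : Finset ℝ} {f f' : ℝ → ℝ → ℝ} (h : ∀ i ∈ S, IsPrimitive (f i) (f' i)) :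
    IsPrimitive (fun x => ∑ i ∈ S, f i x) (fun x => ∑ i ∈ S, f' i x) := by
  refine ⟨fun a b => ?_, fun a b => ?_⟩
  · simpa only [Finset.sum_fn] using
      IntervalIntegrable.sum (f := f') S fun i hi => (h i hi).1 a b
  · rw [intervalIntegral.integral_finsetSum fun i hi => (h i hi).1 a b,
      ← Finset.sum_sub_distrib]
    exact Finset.sum_congr rfl fun i hi => (h i hi).2 a b

lemma comp_sub_right {f f' : ℝ → ℝ} (h : IsPrimitive f f') (c : ℝ) :
    IsPrimitive (fun x => f (x - c)) (fun x => f' (x - c)) :=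
  ⟨fun a b => by simpa using (h.1 (a - c) (b - c)).comp_sub_right c, fun a b => by
    rw [intervalIntegral.integral_comp_sub_right, h.2]⟩

lemma comp_sub_left {f f' : ℝ → ℝ} (h : IsPrimitive f f') (c : ℝ) :
    IsPrimitive (fun x => -f (c - x)) (fun x => f' (c - x)) :=
  ⟨fun a b => by simpa using (h.1 (c - a) (c - b)).comp_sub_left c, fun a b => by
    rw [intervalIntegral.integral_comp_sub_left, h.2]; ring⟩

lemma exists_pos {f f' : ℝ → ℝ} (h : IsPrimitive f f') {σ u v : ℝ} (huv : u < v)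
    (hσ : 0 < σ * (f v - f u)) : ∃ t ∈ Ioo u v, 0 < σ * f' t := by
  by_contra! hcon
  have hle : ∫ x in u..v, σ * f' x ≤ ∫ _ in u..v, (0 : ℝ) :=
    intervalIntegral.integral_mono_on_of_le_Ioo huv.le ((h.1 u v).const_mul σ)
      intervalIntegrable_const hcon
  rw [intervalIntegral.integral_const_mul, h.2, intervalIntegral.integral_zero] at hle
  exact hle.not_gt hσ

end IsPrimitive

lemma isPrimitive_truncPow (m : ℕ) : IsPrimitive (truncPow (m + 1)) (truncPow m) := by
  have hi : ∀ a b, IntervalIntegrable (truncPow m) volume a b := fun a b =>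
    (monotone_truncPow m).intervalIntegrable
  refine ⟨hi, fun a b => ?_⟩
  exact MeasureTheory.integral_eq_of_hasDerivAt_off_countable (truncPow (m + 1)) (truncPow m)
    (countable_singleton (0 : ℝ)) (continuous_truncPow_succ m).continuousOn
    (fun x hx => hasDerivAt_truncPow_succ m hx.2) (hi a b)

/-- `SignAlt f a N σ x` says that `f` takes values of strictly alternating signs at some points
`a < x₁ < ⋯ < x_N = x`, the last one having the sign of `σ`. -/
inductive SignAlt (f : ℝ → ℝ) (a : ℝ) : ℕ → ℝ → ℝ → Prop
  | single {σ x : ℝ} (hx : a < x) (hσ : 0 < σ * f x) : SignAlt f a 1 σ x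
  | snoc {N : ℕ} {σ x y : ℝ} (h : SignAlt f a N σ x) (hxy : x < y) (hσ : 0 < -σ * f y) :
      SignAlt f a (N + 1) (-σ) y

namespace SignAlt

variable {f f' : ℝ → ℝ} {a σ x : ℝ} {N : ℕ}

lemma left_lt (h : SignAlt f a N σ x) : a < x := by
  induction h with
  | single hx _ => exact hx
  | snoc _ hxy _ ih => exact ih.trans hxy

lemma sign_pos (h : SignAlt f a N σ x) : 0 < σ * f x := by
  cases h <;> assumption

/-- Rolle's theorem for sign alternations. -/
lemma primitive (hp : IsPrimitive f f') (h : SignAlt f a (N + 1) σ x) :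
    N = 0 ∨ ∃ y < x, SignAlt f' a N σ y := by
  generalize hM : N + 1 = M at h
  induction h generalizing N with
  | single _ _ => exact .inl (by omega)
  | @snoc M σ x y h hxy hσ ih =>
    obtain rfl : N = M := by omega
    right
    have hs := h.sign_pos
    obtain ⟨t, ht, hft⟩ := hp.exists_pos (σ := -σ) hxy (by linarith)
    obtain _ | N := N
    · cases h
    rcases ih rfl with rfl | ⟨z, hz, hA⟩
    · exact ⟨t, ht.2, .single (h.left_lt.trans ht.1) hft⟩
    · exact ⟨t, ht.2, .snoc hA (hz.trans ht.1) hft⟩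

lemma primitive_left (hp : IsPrimitive f f') (ha : f a = 0) (h : SignAlt f a N σ x) :
    ∃ y < x, SignAlt f' a N σ y := by
  induction h with
  | single hx hσ =>
    obtain ⟨t, ht, hft⟩ := hp.exists_pos hx (by simpa [ha] using hσ)
    exact ⟨t, ht.2, .single ht.1 hft⟩
  | @snoc M σ x y h hxy hσ ih =>
    have hs := h.sign_pos
    obtain ⟨t, ht, hft⟩ := hp.exists_pos (σ := -σ) hxy (by linarith)
    obtain ⟨z, hz, hA⟩ := ih
    exact ⟨t, ht.2, .snoc hA (hz.trans ht.1) hft⟩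

lemma primitive_right (hp : IsPrimitive f f') {b : ℝ} (hb : f b = 0) (hxb : x < b)
    (h : SignAlt f a (N + 1) σ x) : ∃ y < b, SignAlt f' a (N + 1) (-σ) y := by
  have hs := h.sign_pos
  obtain ⟨t, ht, hft⟩ := hp.exists_pos (σ := -σ) hxb (by rw [hb]; linarith)
  rcases h.primitive hp with rfl | ⟨z, hz, hA⟩
  · exact ⟨t, ht.2, .single (h.left_lt.trans ht.1) hft⟩
  · exact ⟨t, ht.2, .snoc hA (hz.trans ht.1) hft⟩

lemma primitive_left_right (hp : IsPrimitive f f') {b : ℝ} (ha : f a = 0) (hb : f b = 0)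
    (hxb : x < b) (h : SignAlt f a N σ x) : ∃ y < b, SignAlt f' a (N + 1) (-σ) y := by
  have hs := h.sign_pos
  obtain ⟨t, ht, hft⟩ := hp.exists_pos (σ := -σ) hxb (by rw [hb]; linarith)
  obtain ⟨z, hz, hA⟩ := h.primitive_left hp ha
  exact ⟨t, ht.2, .snoc hA (hz.trans ht.1) hft⟩

/-- Two values of opposite signs to the right of an alternation lengthen it by one. -/
lemma extend_pair (h : SignAlt f a N σ x) {τ u v : ℝ} (hxu : x < u) (huv : u < v)
    (hu : 0 < τ * f u) (hv : 0 < -τ * f v) : ∃ y, y ≤ v ∧ SignAlt f a (N + 1) (-σ) y := by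
  have hs := h.sign_pos
  by_cases hσu : 0 < -σ * f u
  · exact ⟨u, huv.le, .snoc h hxu hσu⟩
  · refine ⟨v, le_rfl, .snoc h (hxu.trans huv) ?_⟩
    have h0 : σ ≠ 0 := by rintro rfl; simp at hs
    have hfu : f u ≠ 0 := by intro h; simp [h] at hu
    have : 0 < σ * f u := lt_of_le_of_ne (by linarith) (mul_ne_zero h0 hfu).symm
    have h2 : 0 < (τ * f u) * (-τ * f v) := mul_pos hu hv
    have h3 : 0 < -(f u * f v) := by
      have : 0 < τ ^ 2 * -(f u * f v) := by linarith
      exact pos_of_mul_pos_right this (sq_nonneg τ)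
    have h4 : 0 < (f u) ^ 2 * (-σ * f v) := by
      have := mul_pos this h3
      linarith
    exact pos_of_mul_pos_right h4 (sq_nonneg _)

end SignAlt

namespace SignAlt

/-- Zeros of `f`, between any two of which `f` does not vanish identically, force sign
alternations of the derivative. -/
lemma of_zeros {f f' : ℝ → ℝ} {a b : ℝ} {N : ℕ} (hp : IsPrimitive f f')
    (hnz : ∀ u v, a ≤ u → u < v → v ≤ b → ∃ w ∈ Ioo u v, f w ≠ 0)
    (base : ∀ z, a < z → z ≤ b → f z = 0 → ∃ σ, ∃ x < z, SignAlt f' a N σ x)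
    (T : Finset ℝ) (hT : ∀ t ∈ T, f t = 0) :
    ∀ z, a < z → z ≤ b → f z = 0 → (∀ t ∈ T, a < t ∧ t < z) →
      ∃ σ, ∃ x < z, SignAlt f' a (N + T.card) σ x := by
  induction T using Finset.induction_on_max with
  | empty => simpa using base
  | insert m s hm ih =>
    intro z haz hzb hz hTz
    have hmz := hTz m (Finset.mem_insert_self m s)
    have hfm := hT m (Finset.mem_insert_self m s)
    obtain ⟨σ, x, hx, hA⟩ := ih (fun t ht => hT t (Finset.mem_insert_of_mem ht)) m hmz.1
      (hmz.2.le.trans hzb) hfm fun t ht => ⟨(hTz t (Finset.mem_insert_of_mem ht)).1, hm t ht⟩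
    obtain ⟨w, hw, hfw⟩ := hnz m z hmz.1.le hmz.2 hzb
    have hsq : 0 < f w * f w := mul_self_pos.2 hfw
    obtain ⟨u, hu, hfu⟩ := hp.exists_pos (σ := f w) hw.1 (by rw [hfm]; linarith)
    obtain ⟨v, hv, hfv⟩ := hp.exists_pos (σ := -f w) hw.2 (by rw [hz]; linarith)
    obtain ⟨y, hy, hB⟩ := hA.extend_pair (hx.trans hu.1) (hu.2.trans hv.1) hfu hfv
    refine ⟨-σ, y, hy.trans_lt hv.2, ?_⟩
    rwa [Finset.card_insert_of_notMem fun h => (hm m h).false, ← add_assoc]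

/-- Zeros of a nonnegative function, between any two of which it does not vanish identically,
force twice as many sign alternations of the derivative. -/
lemma of_nonneg_zeros {g g' : ℝ → ℝ} {a : ℝ} (hp : IsPrimitive g g') (ha : g a = 0)
    (hpos : ∀ u v, a ≤ u → u < v → ∃ w ∈ Ioo u v, 0 < g w)
    (S : Finset ℝ) (hS : ∀ t ∈ S, g t = 0) :
    ∀ z, a < z → g z = 0 → (∀ t ∈ S, a < t ∧ t < z) →
      ∃ σ < 0, ∃ x < z, SignAlt g' a (2 * S.card + 2) σ x := by
  have key : ∀ m z, a ≤ m → m < z → g m = 0 → g z = 0 →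
      ∃ u v, m < u ∧ u < v ∧ v < z ∧ 0 < g' u ∧ g' v < 0 := by
    intro m z ham hmz hm hz
    obtain ⟨w, hw, hgw⟩ := hpos m z ham hmz
    obtain ⟨u, hu, hgu⟩ := hp.exists_pos (σ := 1) hw.1 (by rw [hm]; linarith)
    obtain ⟨v, hv, hgv⟩ := hp.exists_pos (σ := -1) hw.2 (by rw [hz]; linarith)
    exact ⟨u, v, hu.1, hu.2.trans hv.1, hv.2, by linarith, by linarith⟩
  induction S using Finset.induction_on_max with
  | empty =>
    intro z haz hz _
    obtain ⟨u, v, hau, huv, hvz, hu, hv⟩ := key a z le_rfl haz ha hz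
    exact ⟨-1, by norm_num, v, hvz, .snoc (.single hau (by linarith)) huv (by linarith)⟩
  | insert m s hm ih =>
    intro z haz hz hSz
    have hmz := hSz m (Finset.mem_insert_self m s)
    have hgm := hS m (Finset.mem_insert_self m s)
    obtain ⟨σ, hσ, x, hx, hA⟩ := ih (fun t ht => hS t (Finset.mem_insert_of_mem ht)) m hmz.1
      hgm fun t ht => ⟨(hSz t (Finset.mem_insert_of_mem ht)).1, hm t ht⟩
    obtain ⟨u, v, hmu, huv, hvz, hu, hv⟩ := key m z hmz.1.le hmz.2 hgm hz
    refine ⟨- -σ, by linarith, v, hvz, ?_⟩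
    rw [Finset.card_insert_of_notMem fun h => (hm m h).false]
    exact .snoc (.snoc hA (hx.trans hmu) (mul_pos (by linarith) hu)) huv
      (mul_pos_of_neg_of_neg (by linarith) hv)

end SignAlt

/-- The spline `∑ c_y (y - x)₊^m / m!` in the variable `x`, up to the sign `(-1)^m`. -/
noncomputable def kernelSpline (S : Finset ℝ) (c : ℝ → ℝ) (m : ℕ) (x : ℝ) : ℝ :=
  ∑ y ∈ S, c y * (-1) ^ m * truncPow m (y - x)

/-- The gap `y^{m+1} / (m+1)! - ∑ b_x (y - x)₊^m / m!` as a function of `y`. -/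
noncomputable def gapSpline (T : Finset ℝ) (b : ℝ → ℝ) (m : ℕ) (y : ℝ) : ℝ :=
  y ^ (m + 1) / (m + 1).factorial - ∑ x ∈ T, b x * truncPow m (y - x)

lemma isPrimitive_kernelSpline (S : Finset ℝ) (c : ℝ → ℝ) (m : ℕ) :
    IsPrimitive (kernelSpline S c (m + 1)) (kernelSpline S c m) := by
  have h := IsPrimitive.sum (S := S) fun y _ =>
    ((isPrimitive_truncPow m).comp_sub_left y).const_mul (c y * (-1) ^ m)
  rwa [← funext fun x => show kernelSpline S c (m + 1) x =
    ∑ y ∈ S, c y * (-1) ^ m * -truncPow (m + 1) (y - x) from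
      Finset.sum_congr rfl fun y _ => by ring] at h

lemma isPrimitive_gapSpline (T : Finset ℝ) (b : ℝ → ℝ) (m : ℕ) :
    IsPrimitive (gapSpline T b (m + 1)) (gapSpline T b m) := by
  refine IsPrimitive.sub ⟨fun u v => Continuous.intervalIntegrable (by fun_prop) u v,
    fun u v => ?_⟩ (IsPrimitive.sum fun x _ =>
      ((isPrimitive_truncPow m).comp_sub_right x).const_mul (b x))
  rw [intervalIntegral.integral_div, integral_pow, Nat.factorial_succ (m + 1)]
  push_cast
  field_simp

lemma kernelSpline_eq_zero_of_le {S : Finset ℝ} {c : ℝ → ℝ} {m : ℕ} {x : ℝ}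
    (hx : ∀ y ∈ S, y ≤ x) : kernelSpline S c m x = 0 :=
  Finset.sum_eq_zero fun y hy => by rw [truncPow_of_nonpos (by linarith [hx y hy]), mul_zero]

lemma gapSpline_zero (T : Finset ℝ) (b : ℝ → ℝ) (m : ℕ) (hT : ∀ x ∈ T, 0 < x) :
    gapSpline T b m 0 = 0 := by
  unfold gapSpline
  rw [Finset.sum_eq_zero fun x hx => by
    rw [truncPow_of_nonpos (by linarith [hT x hx]), mul_zero]]
  simp

lemma card_le_of_signAlt_kernelSpline {S : Finset ℝ} {c : ℝ → ℝ} {a σ x : ℝ} {N : ℕ}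
    (h : SignAlt (kernelSpline S c 0) a N σ x) :
    N ≤ 1 + (S.filter fun y => a < y ∧ y ≤ x).card := by
  induction h with
  | single _ _ => omega
  | @snoc N σ x y h hxy hσ ih =>
    have hs := h.sign_pos
    have hex : ∃ s ∈ S, x < s ∧ s ≤ y := by
      by_contra! hcon
      have : kernelSpline S c 0 x = kernelSpline S c 0 y := by
        refine Finset.sum_congr rfl fun s hs => ?_
        rcases le_or_gt s x with hsx | hsx
        · rw [truncPow_of_nonpos (by linarith), truncPow_of_nonpos (by linarith)]
        · have := hcon s hs hsx
          rw [truncPow_of_pos (by linarith), truncPow_of_pos (by linarith)]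
          simp
      rw [this] at hs
      linarith
    obtain ⟨s, hsS, hxs, hsy⟩ := hex
    have : (S.filter fun z => a < z ∧ z ≤ x).card < (S.filter fun z => a < z ∧ z ≤ y).card := by
      refine Finset.card_lt_card (Finset.ssubset_iff_of_subset ?_ |>.2 ⟨s, ?_, ?_⟩)
      · intro z hz
        simp only [Finset.mem_filter] at hz ⊢
        exact ⟨hz.1, hz.2.1, hz.2.2.trans hxy.le⟩
      · simpa only [Finset.mem_filter] using ⟨hsS, h.left_lt.trans hxs, hsy⟩
      · simp only [Finset.mem_filter, not_and, not_le]
        exact fun _ _ => hxs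
    omega

lemma exists_knot_of_gapSpline_le {T : Finset ℝ} {b : ℝ → ℝ} {x y : ℝ} (hxy : x < y)
    (h : gapSpline T b 0 y ≤ gapSpline T b 0 x) : ∃ s ∈ T, x ≤ s ∧ s < y := by
  by_contra! hcon
  have : ∑ s ∈ T, b s * truncPow 0 (y - s) = ∑ s ∈ T, b s * truncPow 0 (x - s) := by
    refine Finset.sum_congr rfl fun s hs => ?_
    rcases lt_or_ge s x with hsx | hsx
    · rw [truncPow_of_pos (by linarith), truncPow_of_pos (by linarith)]
      simp
    · have := hcon s hs hsx
      rw [truncPow_of_nonpos (by linarith), truncPow_of_nonpos (by linarith)]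
  simp only [gapSpline, this, zero_add, pow_one, Nat.factorial_one, Nat.cast_one, div_one] at h
  linarith

lemma card_le_of_signAlt_gapSpline {T : Finset ℝ} {b : ℝ → ℝ} {a σ x : ℝ} {N d : ℕ}
    (hd : ∀ x, a < x → gapSpline T b 0 x < 0 →
      1 ≤ 2 * (T.filter fun s => a < s ∧ s < x).card + d)
    (h : SignAlt (gapSpline T b 0) a N σ x) :
    (σ < 0 → N ≤ 2 * (T.filter fun s => a < s ∧ s < x).card + d) ∧
      N ≤ 2 * (T.filter fun s => a < s ∧ s < x).card + d + 1 := by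
  induction h with
  | @single σ x hx hσ =>
    exact ⟨fun h => hd x hx (by nlinarith), by omega⟩
  | @snoc N σ x y h hxy hσ ih =>
    have hs := h.sign_pos
    have hsub : (T.filter fun s => a < s ∧ s < x) ⊆ T.filter fun s => a < s ∧ s < y := by
      intro z hz
      simp only [Finset.mem_filter] at hz ⊢
      exact ⟨hz.1, hz.2.1, hz.2.2.trans hxy⟩
    rcases lt_or_ge σ 0 with h0 | h0
    · have := Finset.card_le_card hsub
      have := ih.1 h0
      exact ⟨fun h => by linarith, by omega⟩
    · have h1 : 0 < gapSpline T b 0 x := pos_of_mul_pos_right hs h0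
      have h2 : gapSpline T b 0 y < 0 := by
        by_contra! h2
        nlinarith
      obtain ⟨s, hsT, hxs, hsy⟩ := exists_knot_of_gapSpline_le hxy (h2.trans h1).le
      have hlt := Finset.card_lt_card (Finset.ssubset_iff_of_subset hsub |>.2 ⟨s,
        by simpa only [Finset.mem_filter] using ⟨hsT, h.left_lt.trans_le hxs, hsy⟩,
        by simpa only [Finset.mem_filter, not_and, not_lt] using fun _ _ => hxs⟩)
      have := ih.2
      exact ⟨fun _ => by omega, by omega⟩

open Polynomial in
/-- The gap spline is piecewise a nonzero polynomial, so it has finitely many zeros. -/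
lemma finite_zeros_gapSpline (T : Finset ℝ) (b : ℝ → ℝ) (m : ℕ) :
    {y | gapSpline T b m y = 0}.Finite := by
  let P : Finset ℝ → ℝ[X] := fun U =>
    C (1 / ((m + 1).factorial : ℝ)) * X ^ (m + 1) -
      ∑ x ∈ U, C (b x / m.factorial) * (X - C x) ^ m
  have hP : ∀ U, P U ≠ 0 := by
    intro U h0
    have hc : (P U).coeff (m + 1) = 1 / ((m + 1).factorial : ℝ) := by
      have hz : ∀ x ∈ U, (C (b x / m.factorial) * (X - C x) ^ m).coeff (m + 1) = 0 := by
        intro x _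
        rw [coeff_C_mul, coeff_eq_zero_of_natDegree_lt, mul_zero]
        rw [natDegree_pow, natDegree_X_sub_C]
        omega
      simp only [P, coeff_sub, coeff_C_mul_X_pow, finsetSum_coeff, Finset.sum_eq_zero hz]
      simp
    rw [h0, coeff_zero] at hc
    have : (0 : ℝ) < 1 / ((m + 1).factorial : ℝ) := by positivity
    linarith
  refine (T.powerset.finite_toSet.biUnion fun U _ => (P U).rootSet_finite ℝ).subset ?_
  intro y hy
  rw [mem_iUnion₂]
  refine ⟨T.filter (· < y),
    Finset.mem_coe.2 (Finset.mem_powerset.2 (Finset.filter_subset _ _)), ?_⟩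
  rw [mem_rootSet]
  refine ⟨hP _, ?_⟩
  rw [← show gapSpline T b m y = 0 from hy]
  simp only [P, gapSpline, map_sub, map_mul, aeval_C, map_pow, aeval_X, map_sum,
    Algebra.algebraMap_self, RingHom.id_apply]
  rw [Finset.sum_filter]
  congr 1
  · ring
  · refine Finset.sum_congr rfl fun x _ => ?_
    unfold truncPow
    simp only [sub_pos]
    split_ifs <;> ring

open Polynomial in
/-- If the kernel spline vanishes on an interval to the left of its knots, then it and its
derivatives vanish everywhere to the left of the knots. -/
lemma kernelSpline_eq_zero_left {S : Finset ℝ} {c : ℝ → ℝ} {p : ℕ} {u v : ℝ} (huv : u < v)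
    (hv : ∀ y ∈ S, v ≤ y) (h : ∀ x ∈ Ioo u v, kernelSpline S c (p + 1) x = 0) :
    ∀ m ≤ p, ∀ x, (∀ y ∈ S, x ≤ y) → kernelSpline S c (m + 1) x = 0 := by
  let P : ℕ → ℝ[X] := fun m => ∑ y ∈ S, C (c y * (-1) ^ m / m.factorial) * (C y - X) ^ m
  have hP : ∀ m x, (∀ y ∈ S, x ≤ y) → kernelSpline S c (m + 1) x = (P (m + 1)).eval x := by
    intro m x hx
    simp only [P, eval_finsetSum, eval_mul, eval_C, eval_pow, eval_sub, eval_X]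
    refine Finset.sum_congr rfl fun y hy => ?_
    rw [truncPow_succ, max_eq_left (by linarith [hx y hy])]
    ring
  have hder : ∀ m, derivative (P (m + 1)) = P m := by
    intro m
    simp only [P, derivative_sum, derivative_C_mul]
    refine Finset.sum_congr rfl fun y _ => ?_
    rw [derivative_pow_succ, derivative_sub, derivative_C, derivative_X, zero_sub,
      show C (c y * (-1) ^ (m + 1) / ((m + 1).factorial : ℝ)) * (C ((m : ℝ) + 1) * (C y - X) ^ m * -1)
        = C (c y * (-1) ^ (m + 1) / ((m + 1).factorial : ℝ)) * C ((m : ℝ) + 1) * C (-1)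
          * (C y - X) ^ m by simp; ring, ← C_mul, ← C_mul]
    congr 2
    rw [Nat.factorial_succ]
    push_cast
    field_simp
    ring
  have h0 : P (p + 1) = 0 := by
    refine eq_zero_of_infinite_isRoot _ ((Ioo_infinite huv).mono fun x hx => ?_)
    have := h x hx
    rwa [hP p x fun y hy => hx.2.le.trans (hv y hy)] at this
  have hall : ∀ m ≤ p, P (m + 1) = 0 := by
    intro m hm
    induction hm using Nat.decreasingInduction with
    | self => exact h0
    | of_succ k hk ih => rw [← hder, ih, derivative_zero]
  intro m hm x hx
  rw [hP m x hx, hall m hm, eval_zero]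

namespace SignAlt

variable {E : ℕ → ℝ → ℝ} {a b : ℝ}

lemma iterate_primitive (hp : ∀ m, IsPrimitive (E (m + 1)) (E m)) {p N : ℕ} {σ x : ℝ}
    (h : SignAlt (E p) a (N + 1 + p) σ x) : ∃ τ, ∃ y ≤ x, SignAlt (E 0) a (N + 1) τ y := by
  induction p generalizing x with
  | zero => exact ⟨σ, x, le_rfl, h⟩
  | succ p ih =>
    rcases h.primitive (N := N + 1 + p) (hp p) with h0 | ⟨y, hy, hA⟩
    · omega
    · obtain ⟨τ, z, hz, hB⟩ := ih hA
      exact ⟨τ, z, hz.trans hy.le, hB⟩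

lemma iterate_primitive_left (hp : ∀ m, IsPrimitive (E (m + 1)) (E m))
    (ha : ∀ m, E (m + 1) a = 0) {p N : ℕ} {σ x : ℝ} (h : SignAlt (E p) a N σ x) :
    ∃ y ≤ x, SignAlt (E 0) a N σ y := by
  induction p generalizing x with
  | zero => exact ⟨x, le_rfl, h⟩
  | succ p ih =>
    obtain ⟨y, hy, hA⟩ := h.primitive_left (hp p) (ha p)
    obtain ⟨z, hz, hB⟩ := ih hA
    exact ⟨z, hz.trans hy.le, hB⟩

lemma iterate_primitive_right (hp : ∀ m, IsPrimitive (E (m + 1)) (E m))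
    (hb : ∀ m, E m b = 0) {p N : ℕ} {σ x : ℝ} (hxb : x < b)
    (h : SignAlt (E p) a (N + 1) σ x) : ∃ τ, ∃ y < b, SignAlt (E 0) a (N + 1) τ y := by
  induction p generalizing σ x with
  | zero => exact ⟨σ, x, hxb, h⟩
  | succ p ih =>
    obtain ⟨y, hy, hA⟩ := h.primitive_right (hp p) (hb _) hxb
    exact ih hy hA

lemma iterate_primitive_left_right (hp : ∀ m, IsPrimitive (E (m + 1)) (E m))
    (hb : ∀ m, E m b = 0) {p N : ℕ} (ha : ∀ m < p, E (m + 1) a = 0) {σ x : ℝ} (hxb : x < b)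
    (h : SignAlt (E p) a N σ x) : ∃ τ, ∃ y < b, SignAlt (E 0) a (N + p) τ y := by
  induction p generalizing N σ x with
  | zero => exact ⟨σ, x, hxb, h⟩
  | succ p ih =>
    obtain ⟨y, hy, hA⟩ := h.primitive_left_right (hp p) (ha p p.lt_succ_self) (hb _) hxb
    obtain ⟨τ, z, hz, hB⟩ := ih (fun m hm => ha m (hm.trans p.lt_succ_self)) hy hA
    exact ⟨τ, z, hz, by rwa [add_assoc, add_comm 1 p] at hB⟩

end SignAlt

lemma exists_gapSpline_pos {T : Finset ℝ} {b : ℝ → ℝ} {m : ℕ}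
    (hg : ∀ y, 0 < y → 0 ≤ gapSpline T b m y) (u v : ℝ) (hu : 0 ≤ u) (huv : u < v) :
    ∃ w ∈ Ioo u v, 0 < gapSpline T b m w := by
  obtain ⟨w, hw, hw0⟩ := (Ioo_infinite huv).exists_notMem_finite (finite_zeros_gapSpline T b m)
  exact ⟨w, hw, lt_of_le_of_ne (hg w (hu.trans_lt hw.1)) (Ne.symm hw0)⟩

/-- If the kernel spline with the fewest knots vanishing on `T` is zero on an interval, then it
is zero to the left of all its knots. -/
lemma kernelSpline_eq_zero_of_minimal {p : ℕ} {T S : Finset ℝ} {c : ℝ → ℝ}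
    (hmin : ∀ U ⊂ S, (∀ x ∈ T, kernelSpline U c (p + 1) x = 0) → U = ∅)
    (hz : ∀ x ∈ T, kernelSpline S c (p + 1) x = 0) {B u v : ℝ} (hBS : B ∈ S) (huv : u < v)
    (hvB : v ≤ B) (h : ∀ x ∈ Ioo u v, kernelSpline S c (p + 1) x = 0) :
    (∀ y ∈ S, u < y) ∧
      ∀ m ≤ p, ∀ x, (∀ y ∈ S, x ≤ y) → kernelSpline S c (m + 1) x = 0 := by
  have hBU : B ∈ S.filter (u < ·) := Finset.mem_filter.2 ⟨hBS, huv.trans_le hvB⟩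
  have hne : (S.filter (u < ·)).Nonempty := ⟨B, hBU⟩
  have heq : ∀ x, u ≤ x →
      kernelSpline (S.filter (u < ·)) c (p + 1) x = kernelSpline S c (p + 1) x := by
    intro x hx
    refine Finset.sum_subset (Finset.filter_subset _ _) fun y hy hyU => ?_
    have hyu : y ≤ u := by
      by_contra! hcon
      exact hyU (Finset.mem_filter.2 ⟨hy, hcon⟩)
    rw [truncPow_of_nonpos (by linarith), mul_zero]
  have hlt : u < min v ((S.filter (u < ·)).min' hne) :=
    lt_min huv (Finset.mem_filter.1 (Finset.min'_mem _ hne)).2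
  have hleft := kernelSpline_eq_zero_left (c := c) (p := p) hlt
    (fun y hy => (min_le_right _ _).trans (Finset.min'_le _ y hy)) (fun x hx => by
      rw [heq x hx.1.le]
      exact h x ⟨hx.1, hx.2.trans_le (min_le_left _ _)⟩)
  by_cases hU : S.filter (u < ·) = S
  · exact ⟨fun y hy => (Finset.mem_filter.1 (hU.symm ▸ hy)).2, by rwa [hU] at hleft⟩
  · have h0 := hmin _ ((Finset.filter_subset _ _).ssubset_of_ne hU) fun x hx => by
      rcases le_or_gt u x with hux | hux
      · rw [heq x hux, hz x hx]
      · exact hleft p le_rfl x fun y hy => (hux.trans (Finset.mem_filter.1 hy).2).le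
    simp [h0] at hBU

/-- The functionals of evaluation of `y ↦ (y - x)₊^{p+1}`, `x ∈ T`, at the contact points of a
nonnegative gap spline determine the weights on these points. -/
theorem eq_empty_of_kernelSpline_eq_zero {p : ℕ} {T : Finset ℝ} (hT : ∀ x ∈ T, 0 < x)
    {b : ℝ → ℝ} (hg : ∀ y, 0 < y → 0 ≤ gapSpline T b (p + 1) y) (c : ℝ → ℝ) (S : Finset ℝ)
    (hSpos : ∀ y ∈ S, 0 < y) (hS : ∀ y ∈ S, gapSpline T b (p + 1) y = 0)
    (hc : ∀ y ∈ S, c y ≠ 0) (hz : ∀ x ∈ T, kernelSpline S c (p + 1) x = 0) : S = ∅ := by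
  induction S using Finset.strongInduction with
  | H S ih =>
  by_contra hne
  have hne : S.Nonempty := Finset.nonempty_iff_ne_empty.2 hne
  have hmin : ∀ U ⊂ S, (∀ x ∈ T, kernelSpline U c (p + 1) x = 0) → U = ∅ := fun U hU =>
    ih U hU (fun y hy => hSpos y (hU.1 hy)) (fun y hy => hS y (hU.1 hy))
      fun y hy => hc y (hU.1 hy)
  obtain ⟨A, hAS, hA⟩ : ∃ A ∈ S, ∀ y ∈ S, A ≤ y := ⟨_, S.min'_mem hne, S.min'_le⟩
  obtain ⟨B, hBS, hB⟩ : ∃ B ∈ S, ∀ y ∈ S, y ≤ B := ⟨_, S.max'_mem hne, S.le_max'⟩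
  have hB0 := hSpos B hBS
  have hA0 := hSpos A hAS
  have hKB : ∀ m, kernelSpline S c m B = 0 := fun m => kernelSpline_eq_zero_of_le hB
  have hKp := isPrimitive_kernelSpline S c
  have hGp := isPrimitive_gapSpline T b
  by_cases hleft : ∀ m ≤ p, ∀ x, (∀ y ∈ S, x ≤ y) → kernelSpline S c (m + 1) x = 0
  · have hKA : ∀ m ≤ p, kernelSpline S c (m + 1) A = 0 := fun m hm => hleft m hm A hA
    have hAB : A < B := by
      refine lt_of_le_of_ne (hA B hBS) fun hAB => ?_
      have hSB : S = {B} := Finset.eq_singleton_iff_unique_mem.2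
        ⟨hBS, fun y hy => le_antisymm (hB y hy) (hAB ▸ hA y hy)⟩
      have h1 := hleft p le_rfl (B - 1) fun y hy => by linarith [hA y hy]
      rw [hSB, kernelSpline, Finset.sum_singleton, truncPow_of_pos (by linarith)] at h1
      have : ((p + 1).factorial : ℝ) ≠ 0 := by positivity
      simp [hc B hBS, this] at h1
    have hnz : ∀ u v, A ≤ u → u < v → v ≤ B →
        ∃ w ∈ Ioo u v, kernelSpline S c (p + 1) w ≠ 0 := by
      intro u v hu huv hv
      by_contra! hcon
      exact ((kernelSpline_eq_zero_of_minimal hmin hz hBS huv hv hcon).1 A hAS).not_ge hu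
    obtain ⟨σ, x, hx, hK⟩ := SignAlt.of_zeros (hKp p) hnz (N := 2) (fun z hAz hzB h0 => by
        obtain ⟨w, hw, hKw⟩ := hnz A z le_rfl hAz hzB
        have hsq := mul_self_pos.2 hKw
        obtain ⟨u, hu, hfu⟩ := (hKp p).exists_pos (σ := kernelSpline S c (p + 1) w) hw.1
          (by rw [hKA p le_rfl]; linarith)
        obtain ⟨v, hv, hfv⟩ := (hKp p).exists_pos (σ := -kernelSpline S c (p + 1) w) hw.2
          (by rw [h0]; linarith)
        exact ⟨_, v, hv.2, .snoc (.single hu.1 hfu) (hu.2.trans hv.1) hfv⟩)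
      (T.filter fun t => A < t ∧ t < B) (fun t ht => hz t (Finset.mem_filter.1 ht).1) B hAB
      le_rfl (hKB _) fun t ht => (Finset.mem_filter.1 ht).2
    obtain ⟨τ, y, hy, hK0⟩ := hK.iterate_primitive_left_right hKp hKB
      (fun m hm => hKA m hm.le) hx
    have hcard1 := card_le_of_signAlt_kernelSpline hK0
    have hsub1 : (S.filter fun t => A < t ∧ t ≤ y).card ≤ ((S.erase B).erase A).card := by
      refine Finset.card_le_card fun t ht => ?_
      obtain ⟨htS, hAt, hty⟩ := Finset.mem_filter.1 ht
      exact Finset.mem_erase.2 ⟨hAt.ne', Finset.mem_erase.2 ⟨(hty.trans_lt hy).ne, htS⟩⟩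
    obtain ⟨ρ, -, x', hx', hG⟩ := SignAlt.of_nonneg_zeros (hGp p) (hS A hAS)
      (fun u v hu => exists_gapSpline_pos hg u v (hA0.le.trans hu)) ((S.erase B).erase A)
      (fun t ht => hS t (Finset.mem_of_mem_erase (Finset.mem_of_mem_erase ht))) B hAB (hS B hBS)
      (fun t ht => by
        obtain ⟨htA, ht⟩ := Finset.mem_erase.1 ht
        obtain ⟨htB, ht⟩ := Finset.mem_erase.1 ht
        exact ⟨lt_of_le_of_ne (hA t ht) htA.symm, lt_of_le_of_ne (hB t ht) htB⟩)
    obtain ⟨N, hN⟩ : ∃ N, 2 * ((S.erase B).erase A).card + 2 = N + 1 + p :=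
      ⟨2 * ((S.erase B).erase A).card + 1 - p, by omega⟩
    rw [hN] at hG
    obtain ⟨τ', y', hy', hG0⟩ := hG.iterate_primitive hGp
    have hcard2 := (card_le_of_signAlt_gapSpline (d := 1) (fun _ _ _ => by omega) hG0).2
    have hsub2 : (T.filter fun t => A < t ∧ t < y').card ≤
        (T.filter fun t => A < t ∧ t < B).card := by
      refine Finset.card_le_card (Finset.monotone_filter_right _ fun t _ ht => ?_)
      exact ⟨ht.1, ht.2.trans (hy'.trans_lt hx')⟩
    omega
  · have hnz : ∀ u v, 0 ≤ u → u < v → v ≤ B →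
        ∃ w ∈ Ioo u v, kernelSpline S c (p + 1) w ≠ 0 := by
      intro u v _ huv hv
      by_contra! hcon
      exact hleft (kernelSpline_eq_zero_of_minimal hmin hz hBS huv hv hcon).2
    obtain ⟨σ, x, hx, hK⟩ := SignAlt.of_zeros (hKp p) hnz (N := 1) (fun z h0z hzB h0 => by
        obtain ⟨w, hw, hKw⟩ := hnz 0 z le_rfl h0z hzB
        have hsq := mul_self_pos.2 hKw
        obtain ⟨v, hv, hfv⟩ := (hKp p).exists_pos (σ := -kernelSpline S c (p + 1) w) hw.2
          (by rw [h0]; linarith)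
        exact ⟨_, v, hv.2, .single (hw.1.trans hv.1) hfv⟩)
      (T.filter fun t => 0 < t ∧ t < B) (fun t ht => hz t (Finset.mem_filter.1 ht).1) B hB0
      le_rfl (hKB _) fun t ht => (Finset.mem_filter.1 ht).2
    rw [add_comm] at hK
    obtain ⟨τ, y, hy, hK0⟩ := hK.iterate_primitive_right hKp hKB hx
    have hcard1 := card_le_of_signAlt_kernelSpline hK0
    have hsub1 : (S.filter fun t => 0 < t ∧ t ≤ y).card ≤ (S.erase B).card := by
      refine Finset.card_le_card fun t ht => ?_
      obtain ⟨htS, -, hty⟩ := Finset.mem_filter.1 ht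
      exact Finset.mem_erase.2 ⟨(hty.trans_lt hy).ne, htS⟩
    obtain ⟨ρ, hρ, x', hx', hG⟩ := SignAlt.of_nonneg_zeros (hGp p) (gapSpline_zero T b _ hT)
      (exists_gapSpline_pos hg) (S.erase B) (fun t ht => hS t (Finset.mem_of_mem_erase ht))
      B hB0 (hS B hBS) (fun t ht => by
        obtain ⟨htB, ht⟩ := Finset.mem_erase.1 ht
        exact ⟨hSpos t ht, lt_of_le_of_ne (hB t ht) htB⟩)
    obtain ⟨y', hy', hG0⟩ := hG.iterate_primitive_left hGp fun m => gapSpline_zero T b _ hT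
    have hcard2 := (card_le_of_signAlt_gapSpline (d := 0) (fun z hz hGz => by
      obtain ⟨s, hsT, -, hsz⟩ := exists_knot_of_gapSpline_le hz
        (by rw [gapSpline_zero T b 0 hT]; exact hGz.le)
      have : 0 < (T.filter fun s => 0 < s ∧ s < z).card :=
        Finset.card_pos.2 ⟨s, Finset.mem_filter.2 ⟨hsT, hT s hsT, hsz⟩⟩
      omega) hG0).1 hρ
    have hsub2 : (T.filter fun t => 0 < t ∧ t < y').card ≤
        (T.filter fun t => 0 < t ∧ t < B).card := by
      refine Finset.card_le_card (Finset.monotone_filter_right _ fun t _ ht => ?_)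
      exact ⟨ht.1, ht.2.trans (hy'.trans_lt hx')⟩
    omega

lemma eq_of_prod_midpoint_le {ι : Type*} [Fintype ι] {u v : ι → ℝ} (hu : ∀ i, 0 < u i)
    (hv : ∀ i, 0 < v i) (huv : ∏ i, u i = ∏ i, v i)
    (hmid : ∏ i, ((u i + v i) / 2) ≤ ∏ i, u i) : u = v := by
  by_contra hne
  obtain ⟨j, hj⟩ := Function.ne_iff.1 hne
  have hlt : ∏ i, u i * v i < ∏ i, ((u i + v i) / 2) ^ 2 := by
    refine Finset.prod_lt_prod (fun i _ => mul_pos (hu i) (hv i))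
      (fun i _ => by nlinarith [sq_nonneg (u i - v i)]) ⟨j, Finset.mem_univ j, ?_⟩
    have := sq_pos_of_ne_zero (sub_ne_zero.2 hj)
    linarith
  rw [Finset.prod_mul_distrib, Finset.prod_pow, ← huv, ← sq] at hlt
  have h0 : 0 ≤ ∏ i, ((u i + v i) / 2) :=
    Finset.prod_nonneg fun i _ => by linarith [hu i, hv i]
  exact hlt.not_ge (pow_le_pow_left₀ h0 hmid 2)

/-- First-order optimality condition for a product along segments. -/
lemma sum_div_le_card_of_prod_le {ι : Type*} [Fintype ι] {u w : ι → ℝ} (hu : ∀ i, 0 < u i)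
    (hw : ∀ i, 0 ≤ w i)
    (h : ∀ t : ℝ, 0 ≤ t → t ≤ 1 → ∏ i, ((1 - t) * u i + t * w i) ≤ ∏ i, u i) :
    ∑ i, w i / u i ≤ Fintype.card ι := by
  have hle : ∀ t ∈ Ioo (0 : ℝ) 1,
      ∑ i, (w i / u i - 1) / (1 + t * (w i / u i - 1)) ≤ 0 := by
    intro t ht
    have hr : ∀ i, 0 ≤ w i / u i := fun i => div_nonneg (hw i) (hu i).le
    have hpos : ∀ i, 0 < 1 + t * (w i / u i - 1) := fun i => by
      nlinarith [mul_nonneg ht.1.le (hr i), ht.2]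
    have hprod : ∏ i, (1 + t * (w i / u i - 1)) ≤ 1 := by
      have hp : 0 < ∏ i, u i := Finset.prod_pos fun i _ => hu i
      refine le_of_mul_le_mul_left ?_ hp
      rw [mul_one, ← Finset.prod_mul_distrib]
      refine le_of_eq_of_le (Finset.prod_congr rfl fun i _ => ?_) (h t ht.1.le ht.2.le)
      have := (hu i).ne'
      field_simp
      ring
    have hlog : ∑ i, Real.log (1 + t * (w i / u i - 1)) ≤ 0 := by
      rw [← Real.log_prod fun i _ => (hpos i).ne']
      exact Real.log_nonpos (Finset.prod_nonneg fun i _ => (hpos i).le) hprod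
    have hmul : t * ∑ i, (w i / u i - 1) / (1 + t * (w i / u i - 1)) ≤ 0 := by
      refine le_trans ?_ hlog
      rw [Finset.mul_sum]
      refine Finset.sum_le_sum fun i _ => le_of_eq_of_le ?_
        (Real.one_sub_inv_le_log_of_pos (hpos i))
      have := (hpos i).ne'
      field_simp
      ring
    exact nonpos_of_mul_nonpos_right hmul ht.1
  have hcont : ContinuousAt
      (fun t : ℝ => ∑ i, (w i / u i - 1) / (1 + t * (w i / u i - 1))) 0 := by
    refine tendsto_finsetSum _ fun i _ => ContinuousAt.div (by fun_prop) (by fun_prop) (by simp)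
  have hlim : ∑ i, (w i / u i - 1) / (1 + 0 * (w i / u i - 1)) ≤ 0 :=
    le_of_tendsto (hcont.tendsto.mono_left nhdsWithin_le_nhds)
      (Filter.eventually_of_mem (Ioo_mem_nhdsGT one_pos) hle)
  simpa using hlim

/-- Probability measures on `(0, ∞)`. -/
def IsMixing (G : Measure ℝ) : Prop :=
  IsProbabilityMeasure G ∧ G (Iic 0) = 0

lemma kernel_nonneg (k : ℕ) (x : ℝ) {y : ℝ} (hy : 0 < y) :
    0 ≤ (k : ℝ) * max (y - x) 0 ^ (k - 1) / y ^ k := by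
  positivity

lemma kernel_le {k : ℕ} (hk : 2 ≤ k) {x y : ℝ} (hx : 0 < x) (hy : 0 < y) :
    (k : ℝ) * max (y - x) 0 ^ (k - 1) / y ^ k ≤ k / x := by
  obtain ⟨p, rfl⟩ := Nat.exists_eq_add_of_le' hk
  rcases le_or_gt y x with hyx | hxy
  · rw [max_eq_right (by linarith)]
    simp
    positivity
  · rw [max_eq_left (by linarith), div_le_div_iff₀ (by positivity) hx, mul_assoc]
    refine mul_le_mul_of_nonneg_left ?_ (by positivity)
    rw [show p + 2 - 1 = p + 1 from rfl, pow_succ y (p + 1)]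
    exact mul_le_mul (pow_le_pow_left₀ (by linarith) (by linarith) _) hxy.le hx.le (by positivity)

namespace IsMixing

variable {G G₁ G₂ : Measure ℝ}

lemma ae_pos (hG : IsMixing G) : ∀ᵐ y ∂G, 0 < y := by
  rw [ae_iff]
  convert hG.2 using 2
  ext y
  simp

lemma integrable_kernel (hG : IsMixing G) {k : ℕ} (hk : 2 ≤ k) {x : ℝ} (hx : 0 < x) :
    Integrable (fun y => (k : ℝ) * max (y - x) 0 ^ (k - 1) / y ^ k) G := by
  have := hG.1
  refine Integrable.of_bound (C := k / x) ?_ ?_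
  · exact Measurable.aestronglyMeasurable (by fun_prop)
  · filter_upwards [hG.ae_pos] with y hy
    rw [Real.norm_of_nonneg (kernel_nonneg k x hy)]
    exact kernel_le hk hx hy

lemma mixDens_nonneg (hG : IsMixing G) (k : ℕ) (x : ℝ) : 0 ≤ mixDens k G x :=
  integral_nonneg_of_ae <| by filter_upwards [hG.ae_pos] with y hy using kernel_nonneg k x hy

lemma dirac {y : ℝ} (hy : 0 < y) : IsMixing (Measure.dirac y) :=
  ⟨inferInstance, by simp [hy]⟩

lemma exists_segment (h₁ : IsMixing G₁) (h₂ : IsMixing G₂) {k : ℕ} (hk : 2 ≤ k) {t : ℝ}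
    (ht0 : 0 ≤ t) (ht1 : t ≤ 1) : ∃ G, IsMixing G ∧
      ∀ x, 0 < x → mixDens k G x = (1 - t) * mixDens k G₁ x + t * mixDens k G₂ x := by
  have := h₁.1
  have := h₂.1
  refine ⟨ENNReal.ofReal (1 - t) • G₁ + ENNReal.ofReal t • G₂, ⟨⟨?_⟩, ?_⟩, fun x hx => ?_⟩
  · simp [← ENNReal.ofReal_add (sub_nonneg.2 ht1) ht0]
  · simp [h₁.2, h₂.2]
  · unfold mixDens
    rw [integral_add_measure ((h₁.integrable_kernel hk hx).smul_measure ENNReal.ofReal_ne_top)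
      ((h₂.integrable_kernel hk hx).smul_measure ENNReal.ofReal_ne_top), integral_smul_measure,
      integral_smul_measure, ENNReal.toReal_ofReal (sub_nonneg.2 ht1), ENNReal.toReal_ofReal ht0,
      smul_eq_mul, smul_eq_mul]

end IsMixing

lemma mixDens_dirac (k : ℕ) (x y : ℝ) :
    mixDens k (Measure.dirac y) x = (k : ℝ) * max (y - x) 0 ^ (k - 1) / y ^ k :=
  integral_dirac _ _

/-- `G` maximizes the likelihood over all mixing measures. -/
def IsMLE (k n : ℕ) (X : Fin n → ℝ) (G : Measure ℝ) : Prop :=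
  IsMixing G ∧ ∀ H, IsMixing H → lik k n X H ≤ lik k n X G

namespace IsMLE

variable {k n : ℕ} {X : Fin n → ℝ} {G G₁ G₂ : Measure ℝ}

lemma mixDens_pos (hk : 2 ≤ k) (hXpos : ∀ i, 0 < X i) (h : IsMLE k n X G) (i : Fin n) :
    0 < mixDens k G (X i) := by
  have hlik : 0 < lik k n X G := by
    have hlt : ∀ j, X j < ∑ j, X j + 1 := fun j => by
      linarith [Finset.single_le_sum (fun j _ => (hXpos j).le) (Finset.mem_univ j)]
    have hy : 0 < ∑ j, X j + 1 := (hXpos i).trans (hlt i)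
    refine lt_of_lt_of_le (Finset.prod_pos fun j _ => ?_) (h.2 _ (IsMixing.dirac hy))
    rw [mixDens_dirac, max_eq_left (by linarith [hlt j])]
    have := sub_pos.2 (hlt j)
    positivity
  refine lt_of_le_of_ne (h.1.mixDens_nonneg k _) fun h0 => hlik.ne' ?_
  exact Finset.prod_eq_zero (Finset.mem_univ i) h0.symm

lemma mixDens_eq (hk : 2 ≤ k) (hXpos : ∀ i, 0 < X i) (h₁ : IsMLE k n X G₁)
    (h₂ : IsMLE k n X G₂) : (fun i => mixDens k G₁ (X i)) = fun i => mixDens k G₂ (X i) := by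
  refine eq_of_prod_midpoint_le (h₁.mixDens_pos hk hXpos) (h₂.mixDens_pos hk hXpos)
    (le_antisymm (h₂.2 _ h₁.1) (h₁.2 _ h₂.1)) ?_
  obtain ⟨H, hH, hHeq⟩ := h₁.1.exists_segment h₂.1 hk (t := 1 / 2) (by norm_num) (by norm_num)
  refine le_of_eq_of_le (Finset.prod_congr rfl fun i _ => ?_) (h₁.2 H hH)
  rw [hHeq _ (hXpos i)]
  ring

/-- The directional derivative towards a point mass is nonpositive. -/
lemma sum_kernel_div_le (hk : 2 ≤ k) (hXpos : ∀ i, 0 < X i) (h : IsMLE k n X G) {y : ℝ}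
    (hy : 0 < y) :
    ∑ i, (k : ℝ) * max (y - X i) 0 ^ (k - 1) / y ^ k / mixDens k G (X i) ≤ n := by
  have := sum_div_le_card_of_prod_le (h.mixDens_pos hk hXpos)
    (fun i => kernel_nonneg k (X i) hy) fun t ht0 ht1 => by
      obtain ⟨H, hH, hHeq⟩ := h.1.exists_segment (IsMixing.dirac hy) hk ht0 ht1
      refine le_of_eq_of_le (Finset.prod_congr rfl fun i _ => ?_) (h.2 H hH)
      rw [hHeq _ (hXpos i), mixDens_dirac]
  simpa using this

lemma ae_sum_kernel_div_eq (hk : 2 ≤ k) (hXpos : ∀ i, 0 < X i) (h : IsMLE k n X G) :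
    ∀ᵐ y ∂G, ∑ i, (k : ℝ) * max (y - X i) 0 ^ (k - 1) / y ^ k / mixDens k G (X i) = n := by
  have := h.1.1
  have hint : ∀ i ∈ Finset.univ, Integrable
      (fun y => (k : ℝ) * max (y - X i) 0 ^ (k - 1) / y ^ k / mixDens k G (X i)) G :=
    fun i _ => (h.1.integrable_kernel hk (hXpos i)).div_const _
  have h0 : ∫ y, ((n : ℝ) -
      ∑ i, (k : ℝ) * max (y - X i) 0 ^ (k - 1) / y ^ k / mixDens k G (X i)) ∂G = 0 := by
    rw [integral_sub (integrable_const _) (integrable_finsetSum _ hint),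
      integral_finsetSum _ hint]
    have : ∀ i, ∫ y, (k : ℝ) * max (y - X i) 0 ^ (k - 1) / y ^ k / mixDens k G (X i) ∂G = 1 :=
      fun i => by
        rw [integral_div]
        exact div_self (h.mixDens_pos hk hXpos i).ne'
    simp [this]
  have hae := (integral_eq_zero_iff_of_nonneg_ae
    (by filter_upwards [h.1.ae_pos] with y hy using sub_nonneg.2 (h.sum_kernel_div_le hk hXpos hy))
    ((integrable_const _).sub (integrable_finsetSum _ hint))).1 h0
  filter_upwards [hae] with y hy
  exact (sub_eq_zero.1 hy).symm

end IsMLE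

lemma gapSpline_eq_mul {p n : ℕ} (hn : 1 ≤ n) {X : Fin n → ℝ} (hX : StrictMono X) (f : ℝ → ℝ)
    {y : ℝ} (hy : 0 < y) :
    gapSpline (Finset.univ.image X) (fun x => 1 / (n * f x)) (p + 1) y =
      y ^ (p + 2) / ((p + 2).factorial * n) * (n -
        ∑ i, ((p + 2 : ℕ) : ℝ) * max (y - X i) 0 ^ (p + 2 - 1) / y ^ (p + 2) / f (X i)) := by
  have hn0 : (n : ℝ) ≠ 0 := by positivity
  rw [gapSpline, Finset.sum_image hX.injective.injOn, mul_sub, Finset.mul_sum]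
  congr 1
  · field_simp
  · refine Finset.sum_congr rfl fun i _ => ?_
    rw [truncPow_succ, show p + 2 - 1 = p + 1 from rfl, Nat.factorial_succ (p + 1)]
    push_cast
    field_simp
    ring

lemma integral_eq_sum_of_ae_mem {G : Measure ℝ} [IsFiniteMeasure G] {F : Finset ℝ}
    (h : ∀ᵐ y ∂G, y ∈ F) (φ : ℝ → ℝ) : ∫ y, φ y ∂G = ∑ y ∈ F, G.real {y} * φ y := by
  have hr : G.restrict (F : Set ℝ) = G := Measure.restrict_eq_self_of_ae_mem h
  conv_lhs => rw [← hr]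
  rw [setIntegral_finset _ IntegrableOn.finset]
  rfl

lemma measure_eq_of_ae_mem {G₁ G₂ : Measure ℝ} {F : Finset ℝ} (h₁ : ∀ᵐ y ∂G₁, y ∈ F)
    (h₂ : ∀ᵐ y ∂G₂, y ∈ F) (h : ∀ y ∈ F, G₁ {y} = G₂ {y}) : G₁ = G₂ := by
  classical
  have key : ∀ G : Measure ℝ, (∀ᵐ y ∂G, y ∈ F) → ∀ s, G s = ∑ y ∈ F.filter (· ∈ s), G {y} := by
    intro G hG s
    rw [sum_measure_singleton]
    refine measure_congr ?_
    filter_upwards [hG] with y hy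
    exact propext ⟨fun hs => by simpa using ⟨hy, hs⟩, fun hs => (Finset.mem_filter.1 hs).2⟩
  ext s _
  rw [key G₁ h₁, key G₂ h₂]
  exact Finset.sum_congr rfl fun y hy => h y (Finset.mem_filter.1 hy).1

theorem IsMLE.unique {k n : ℕ} (hk : 2 ≤ k) (hn : 1 ≤ n) {X : Fin n → ℝ} (hX : StrictMono X)
    (hXpos : ∀ i, 0 < X i) {G₁ G₂ : Measure ℝ} (h₁ : IsMLE k n X G₁) (h₂ : IsMLE k n X G₂) :
    G₁ = G₂ := by
  have := h₁.1.1
  have := h₂.1.1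
  have hf := congrFun (h₁.mixDens_eq hk hXpos h₂)
  obtain ⟨p, rfl⟩ := Nat.exists_eq_add_of_le' hk
  set T := Finset.univ.image X
  set b : ℝ → ℝ := fun x => 1 / (n * mixDens (p + 2) G₁ x)
  have hn0 : (0 : ℝ) < n := by positivity
  have hg : ∀ y, 0 < y → 0 ≤ gapSpline T b (p + 1) y := fun y hy => by
    rw [gapSpline_eq_mul hn hX _ hy]
    exact mul_nonneg (by positivity) (sub_nonneg.2 (h₁.sum_kernel_div_le hk hXpos hy))
  have hfin : {y | 0 < y ∧ gapSpline T b (p + 1) y = 0}.Finite :=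
    (finite_zeros_gapSpline T b (p + 1)).subset fun y hy => hy.2
  have hF₁ : ∀ᵐ y ∂G₁, y ∈ hfin.toFinset := by
    filter_upwards [h₁.1.ae_pos, h₁.ae_sum_kernel_div_eq hk hXpos] with y hy hsum
    rw [Set.Finite.mem_toFinset]
    exact ⟨hy, by rw [gapSpline_eq_mul hn hX _ hy, hsum, sub_self, mul_zero]⟩
  have hF₂ : ∀ᵐ y ∂G₂, y ∈ hfin.toFinset := by
    filter_upwards [h₂.1.ae_pos, h₂.ae_sum_kernel_div_eq hk hXpos] with y hy hsum
    rw [Set.Finite.mem_toFinset]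
    refine ⟨hy, ?_⟩
    simp only [← hf] at hsum
    rw [gapSpline_eq_mul hn hX _ hy, hsum, sub_self, mul_zero]
  set F := hfin.toFinset
  have hF : ∀ y ∈ F, 0 < y ∧ gapSpline T b (p + 1) y = 0 := fun y hy =>
    (Set.Finite.mem_toFinset hfin).1 hy
  set c : ℝ → ℝ := fun y => (G₁.real {y} - G₂.real {y}) / y ^ (p + 2)
  have hempty : F.filter (fun y => c y ≠ 0) = ∅ := by
    refine eq_empty_of_kernelSpline_eq_zero (T := T) (b := b) (p := p) ?_ hg c _
      (fun y hy => (hF y (Finset.mem_filter.1 hy).1).1)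
      (fun y hy => (hF y (Finset.mem_filter.1 hy).1).2) (fun y hy => (Finset.mem_filter.1 hy).2) ?_
    · intro x hx
      obtain ⟨i, -, rfl⟩ := Finset.mem_image.1 hx
      exact hXpos i
    · intro x hx
      obtain ⟨i, -, rfl⟩ := Finset.mem_image.1 hx
      have hi : mixDens (p + 2) G₁ (X i) - mixDens (p + 2) G₂ (X i) = 0 := sub_eq_zero.2 (hf i)
      rw [mixDens, mixDens, integral_eq_sum_of_ae_mem hF₁, integral_eq_sum_of_ae_mem hF₂,
        ← Finset.sum_sub_distrib] at hi
      have hsub : kernelSpline (F.filter fun y => c y ≠ 0) c (p + 1) (X i) =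
          kernelSpline F c (p + 1) (X i) := by
        refine Finset.sum_subset (Finset.filter_subset _ _) fun y hy hyc => ?_
        have : c y = 0 := by
          by_contra hc
          exact hyc (Finset.mem_filter.2 ⟨hy, hc⟩)
        rw [this, zero_mul, zero_mul]
      rw [hsub, ← mul_zero ((-1) ^ (p + 1) / ((p + 2 : ℕ) * (p + 1).factorial : ℝ)), ← hi,
        Finset.mul_sum]
      refine Finset.sum_congr rfl fun y hy => ?_
      have := (hF y hy).1
      rw [truncPow_succ, show p + 2 - 1 = p + 1 from rfl]
      simp only [c]
      field_simp
  refine measure_eq_of_ae_mem hF₁ hF₂ fun y hy => ?_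
  have hc : c y = 0 := by
    by_contra hc
    exact Finset.notMem_empty y (hempty ▸ Finset.mem_filter.2 ⟨hy, hc⟩)
  have hy0 : y ^ (p + 2) ≠ 0 := (pow_pos (hF y hy).1 _).ne'
  have := (div_eq_zero_iff.1 hc).resolve_right hy0
  exact (measureReal_eq_measureReal_iff).1 (sub_eq_zero.1 this)

/-- The maximum likelihood estimator is unique: any two probability measures on
`(0, ∞)` that both maximize the likelihood are equal. -/
theorem mle_unique (k n : ℕ) (hk : 2 ≤ k) (hn : 1 ≤ n)
    (X : Fin n → ℝ) (hX : StrictMono X) (hXpos : ∀ i, 0 < X i)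
    (G₁ G₂ : Measure ℝ)
    (hG₁p : IsProbabilityMeasure G₁) (hG₁s : G₁ (Iic 0) = 0)
    (hG₂p : IsProbabilityMeasure G₂) (hG₂s : G₂ (Iic 0) = 0)
    (hG₁max : ∀ G : Measure ℝ, IsProbabilityMeasure G → G (Iic 0) = 0 →
      lik k n X G ≤ lik k n X G₁)
    (hG₂max : ∀ G : Measure ℝ, IsProbabilityMeasure G → G (Iic 0) = 0 →
      lik k n X G ≤ lik k n X G₂) :
    G₁ = G₂ := by
  exact IsMLE.unique hk hn hX hXpos ⟨⟨hG₁p, hG₁s⟩, fun H hH => hG₁max H hH.1 hH.2⟩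
    ⟨⟨hG₂p, hG₂s⟩, fun H hH => hG₂max H hH.1 hH.2⟩
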